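/- Suppose b > 0 (a ∈ ℝ arbitrary). Then for every t > 0 and every Δ ≥ 0, Cov(X(t), X(t+Δ)) > 0. -/

import Mathlib

open MeasureTheory ProbabilityTheory Filter Real Set

noncomputable section

/-- `B` is a standard one-dimensional Brownian motion adapted to the filtration `F`
under the probability measure `P`: all paths are continuous and start at `0`, the
increment `B t - B s` is Gaussian with mean `0` and variance `t - s`, and increments
after time `s` are independent of `F s`. -/
def IsStdBrownian {Ω : Type*} {mΩ : MeasurableSpace Ω} (P : Measure Ω)
    (F : MeasureTheory.Filtration ℝ mΩ) (B : ℝ → Ω → ℝ) : Prop :=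
  MeasureTheory.Adapted F B ∧
  (∀ ω, B 0 ω = 0) ∧
  (∀ ω, Continuous fun t => B t ω) ∧
  (∀ s t : ℝ, 0 ≤ s → s ≤ t →
    P.map (fun ω => B t ω - B s ω) = gaussianReal 0 (Real.toNNReal (t - s))) ∧
  (∀ s t : ℝ, 0 ≤ s → s ≤ t →
    Indep (MeasurableSpace.comap (fun ω => B t ω - B s ω) Real.measurableSpace) (F s) P)

/-- `X` is the (continuous, adapted) solution of the affine stochastic functional
differential equation `dX(t) = (a X(t) + b/(1+t) ∫_{-1}^t X(s) ds) dt + σ dB(t)` for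
`t ≥ 0`, with initial history `ψ` on `[-1, 0]`; i.e. almost surely, for all `t ≥ 0`,
`X t = ψ 0 + ∫_0^t (a X(s) + b/(1+s) (∫_{-1}^0 ψ(u) du + ∫_0^s X(u) du)) ds + σ B t`. -/
def IsSolutionSFDE {Ω : Type*} {mΩ : MeasurableSpace Ω} (P : Measure Ω)
    (F : MeasureTheory.Filtration ℝ mΩ) (a b σ : ℝ) (ψ : ℝ → ℝ)
    (B X : ℝ → Ω → ℝ) : Prop :=
  (∀ t : ℝ, 0 ≤ t → StronglyMeasurable[F t] (X t)) ∧
  (∀ ω, ContinuousOn (fun t => X t ω) (Set.Ici (0 : ℝ))) ∧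
  (∀ᵐ ω ∂P, ∀ t : ℝ, 0 ≤ t →
    X t ω = ψ 0
      + (∫ s in (0:ℝ)..t,
          (a * X s ω + b / (1 + s) * ((∫ u in (-1:ℝ)..(0:ℝ), ψ u) + ∫ u in (0:ℝ)..s, X u ω)))
      + σ * B t ω)

/-- The covariance `Cov(Y, Z) = E[Y Z] - E[Y] E[Z]` of two real random variables. -/
def rcov {Ω : Type*} {mΩ : MeasurableSpace Ω} (P : Measure Ω) (Y Z : Ω → ℝ) : ℝ :=
  (∫ ω, Y ω * Z ω ∂P) - (∫ ω, Y ω ∂P) * (∫ ω, Z ω ∂P)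

theorem integral_le_of_le_add_mul_integral {p g : ℝ → ℝ} {L T : ℝ} (hp : Continuous p)
    (hg : Continuous g) (hg0 : ∀ t, 0 ≤ g t) (hL : 0 ≤ L)
    (h : ∀ t ∈ Icc 0 T, p t ≤ g t + L * ∫ s in (0 : ℝ)..t, p s) {t : ℝ} (ht : t ∈ Icc 0 T) :
    ∫ s in (0 : ℝ)..t, p s ≤ exp (L * t) * ∫ s in (0 : ℝ)..t, g s := by
  have hder : ∀ x, HasDerivAt (fun x => exp (-(L * x)) * (∫ s in (0 : ℝ)..x, p s)
      - ∫ s in (0 : ℝ)..x, g s)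
      (exp (-(L * x)) * (-L) * (∫ s in (0 : ℝ)..x, p s) + exp (-(L * x)) * p x - g x) x := by
    intro x
    have h1 : HasDerivAt (fun x => exp (-(L * x))) (exp (-(L * x)) * (-L)) x := by
      have := ((hasDerivAt_id x).const_mul L).neg.exp
      simpa using this
    exact (h1.mul (hp.integral_hasStrictDerivAt 0 x).hasDerivAt).sub
      (hg.integral_hasStrictDerivAt 0 x).hasDerivAt
  have hanti : AntitoneOn (fun x => exp (-(L * x)) * (∫ s in (0 : ℝ)..x, p s)
      - ∫ s in (0 : ℝ)..x, g s) (Icc 0 T) := by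
    refine antitoneOn_of_deriv_nonpos (convex_Icc 0 T)
      (fun x _ => (hder x).continuousAt.continuousWithinAt)
      (fun x _ => (hder x).differentiableAt.differentiableWithinAt) fun x hx => ?_
    rw [(hder x).deriv]
    have hx' := interior_subset hx
    have h1 := h x hx'
    have h2 : exp (-(L * x)) ≤ 1 := exp_le_one_iff.2 (by nlinarith [hx'.1])
    nlinarith [exp_pos (-(L * x)), hg0 x, mul_le_mul_of_nonneg_left h1 (exp_pos (-(L * x))).le,
      mul_le_mul_of_nonneg_right h2 (hg0 x)]
  have := hanti ⟨le_rfl, ht.1.trans ht.2⟩ ht ht.1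
  simp only [intervalIntegral.integral_same, mul_zero, sub_zero] at this
  have h3 := mul_le_mul_of_nonneg_left (sub_nonpos.1 this) (exp_pos (L * t)).le
  rwa [← mul_assoc, ← exp_add, add_neg_cancel, exp_zero, one_mul] at h3

theorem volterra_lower_bound {d w f : ℝ → ℝ} {a : ℝ} (hd : Continuous d) (hw : Continuous w)
    (hf0 : 0 ≤ f 0) (hf : MonotoneOn f (Ici 0))
    (h : ∀ t, 0 ≤ t → d t = (∫ s in (0 : ℝ)..t, (a * d s + w s * ∫ u in (0 : ℝ)..s, d u)) + f t)
    {t : ℝ} (ht : 0 ≤ t) :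
    min 1 (exp (a * t)) * f t
      + exp (a * t) * ∫ s in (0 : ℝ)..t, exp (-(a * s)) * (w s * ∫ u in (0 : ℝ)..s, d u) ≤ d t := by
  set D : ℝ → ℝ := fun s => ∫ u in (0 : ℝ)..s, d u with hD
  have hDc : Continuous D :=
    intervalIntegral.continuous_primitive (fun _ _ => hd.intervalIntegrable _ _) 0
  set H : ℝ → ℝ := fun t => ∫ s in (0 : ℝ)..t, (a * d s + w s * D s) with hH
  have hi : Continuous fun s => a * d s + w s * D s := by fun_prop
  have hHd : ∀ x, HasDerivAt H (a * d x + w x * D x) x := fun x =>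
    (hi.integral_hasStrictDerivAt 0 x).hasDerivAt
  have hHc : Continuous H := continuous_iff_continuousAt.2 fun x => (hHd x).continuousAt
  have hexp : ∀ x, HasDerivAt (fun x => exp (-(a * x))) (exp (-(a * x)) * (-a)) x := by
    intro x
    simpa using ((hasDerivAt_id x).const_mul a).neg.exp
  have hfe : ∀ s, 0 ≤ s → f s = d s - H s := fun s hs => by rw [h s hs]; ring
  have hG : exp (-(a * t)) * H t
      = (∫ s in (0 : ℝ)..t, exp (-(a * s)) * (a * (d s - H s)))
        + ∫ s in (0 : ℝ)..t, exp (-(a * s)) * (w s * D s) := by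
    rw [← intervalIntegral.integral_add (by apply Continuous.intervalIntegrable; fun_prop)
      (by apply Continuous.intervalIntegrable; fun_prop)]
    rw [intervalIntegral.integral_eq_sub_of_hasDerivAt (f := fun x => exp (-(a * x)) * H x)]
    · simp [hH]
    · intro x _
      exact ((hexp x).mul (hHd x)).congr_deriv (by ring)
    · apply Continuous.intervalIntegrable; fun_prop
  have hft : 0 ≤ f t := hf0.trans (hf self_mem_Ici ht ht)
  have hlow : min 1 (exp (a * t)) * f t
      ≤ f t + exp (a * t) * ∫ s in (0 : ℝ)..t, exp (-(a * s)) * (a * (d s - H s)) := by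
    rcases le_total 0 a with ha | ha
    · have h1 : 0 ≤ ∫ s in (0 : ℝ)..t, exp (-(a * s)) * (a * (d s - H s)) := by
        refine intervalIntegral.integral_nonneg ht fun s hs => ?_
        rw [← hfe s hs.1]
        have := hf0.trans (hf self_mem_Ici hs.1 hs.1)
        positivity
      nlinarith [min_le_left 1 (exp (a * t)), mul_nonneg (exp_pos (a * t)).le h1]
    · have h1 : ∫ s in (0 : ℝ)..t, exp (-(a * s)) * (a * f t)
          ≤ ∫ s in (0 : ℝ)..t, exp (-(a * s)) * (a * (d s - H s)) := by
        refine intervalIntegral.integral_mono_on ht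
          (by apply Continuous.intervalIntegrable; fun_prop)
          (by apply Continuous.intervalIntegrable; fun_prop) fun s hs => ?_
        rw [← hfe s hs.1]
        exact mul_le_mul_of_nonneg_left
          (mul_le_mul_of_nonpos_left (hf hs.1 ht hs.2) ha) (exp_pos _).le
      have h2 : ∫ s in (0 : ℝ)..t, exp (-(a * s)) * (a * f t) = (1 - exp (-(a * t))) * f t := by
        rw [intervalIntegral.integral_eq_sub_of_hasDerivAt (f := fun x => -(exp (-(a * x)) * f t))]
        · simp; ring
        · intro x _
          exact ((hexp x).mul_const (f t)).neg.congr_deriv (by ring)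
        · apply Continuous.intervalIntegrable; fun_prop
      rw [h2] at h1
      have h3 := mul_le_mul_of_nonneg_left h1 (exp_pos (a * t)).le
      have h4 : exp (a * t) * exp (-(a * t)) = 1 := by rw [← exp_add]; simp
      have h5 : exp (a * t) * ((1 - exp (-(a * t))) * f t) = exp (a * t) * f t - f t := by
        linear_combination (-f t) * h4
      nlinarith [min_le_right 1 (exp (a * t))]
  have h4 : exp (a * t) * exp (-(a * t)) = 1 := by rw [← exp_add]; simp
  have h6 : H t = exp (a * t) * (exp (-(a * t)) * H t) := by rw [← mul_assoc, h4, one_mul]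
  have h7 : d t = H t + f t := h t ht
  rw [hG] at h6
  linarith

theorem volterra_integral_nonneg {d w f : ℝ → ℝ} {a : ℝ} (hd : Continuous d) (hw : Continuous w)
    (hw0 : ∀ t, 0 ≤ w t) (hf0 : 0 ≤ f 0) (hf : MonotoneOn f (Ici 0))
    (h : ∀ t, 0 ≤ t → d t = (∫ s in (0 : ℝ)..t, (a * d s + w s * ∫ u in (0 : ℝ)..s, d u)) + f t)
    {t : ℝ} (ht : 0 ≤ t) : 0 ≤ ∫ u in (0 : ℝ)..t, d u := by
  set D : ℝ → ℝ := fun s => ∫ u in (0 : ℝ)..s, d u with hD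
  have hDc : Continuous D :=
    intervalIntegral.continuous_primitive (fun _ _ => hd.intervalIntegrable _ _) 0
  set p : ℝ → ℝ := fun s => max 0 (-D s) with hp
  have hpc : Continuous p := by fun_prop
  have hp0 : ∀ s, 0 ≤ p s := fun s => le_max_left _ _
  have hpD : ∀ s, -p s ≤ D s := fun s => neg_le.1 (le_max_right _ _)
  obtain ⟨C, hC⟩ : ∃ C, ∀ s ∈ Icc 0 t, exp (-(a * s)) * w s ≤ C := by
    obtain ⟨C, hC⟩ := (isCompact_Icc (a := (0 : ℝ)) (b := t)).bddAbove_image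
      (f := fun s => exp (-(a * s)) * w s) (by fun_prop)
    exact ⟨C, fun s hs => hC ⟨s, hs, rfl⟩⟩
  have hC0 : 0 ≤ C := le_trans (mul_nonneg (exp_pos _).le (hw0 0)) (hC 0 ⟨le_rfl, ht⟩)
  obtain ⟨E, hE⟩ : ∃ E, ∀ s ∈ Icc 0 t, exp (a * s) ≤ E := by
    obtain ⟨C, hC⟩ := (isCompact_Icc (a := (0 : ℝ)) (b := t)).bddAbove_image
      (f := fun s => exp (a * s)) (by fun_prop)
    exact ⟨C, fun s hs => hC ⟨s, hs, rfl⟩⟩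
  have hE0 : 0 ≤ E := le_trans (exp_pos _).le (hE 0 ⟨le_rfl, ht⟩)
  have hM0 : ∀ s, 0 ≤ s → 0 ≤ ∫ u in (0 : ℝ)..s, p u := fun s hs =>
    intervalIntegral.integral_nonneg hs fun u _ => hp0 u
  have hMmono : ∀ s ∈ Icc 0 t, ∀ r ∈ Icc 0 s, ∫ u in (0 : ℝ)..r, p u ≤ ∫ u in (0 : ℝ)..s, p u := by
    intro s hs r hr
    exact intervalIntegral.integral_mono_interval le_rfl hr.1 hr.2 (ae_of_all _ hp0)
      (hpc.intervalIntegrable _ _)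
  have hdlow : ∀ s ∈ Icc 0 t, -(E * (C * ∫ u in (0 : ℝ)..s, p u)) ≤ d s := by
    intro s hs
    have h1 := volterra_lower_bound hd hw hf0 hf h hs.1
    have h2 : 0 ≤ min 1 (exp (a * s)) * f s :=
      mul_nonneg (le_min zero_le_one (exp_pos _).le) (hf0.trans (hf self_mem_Ici hs.1 hs.1))
    have h3 : -(C * ∫ u in (0 : ℝ)..s, p u)
        ≤ ∫ r in (0 : ℝ)..s, exp (-(a * r)) * (w r * D r) := by
      rw [← intervalIntegral.integral_const_mul, ← intervalIntegral.integral_neg]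
      refine intervalIntegral.integral_mono_on hs.1
          (by apply Continuous.intervalIntegrable; fun_prop)
          (by apply Continuous.intervalIntegrable; fun_prop) fun r hr => ?_
      rw [← mul_assoc]
      have h4 := hC r ⟨hr.1, hr.2.trans hs.2⟩
      have h5 : 0 ≤ exp (-(a * r)) * w r := mul_nonneg (exp_pos _).le (hw0 r)
      nlinarith [mul_le_mul_of_nonneg_left (hpD r) h5, mul_le_mul_of_nonneg_right h4 (hp0 r)]
    have h6 := mul_le_mul_of_nonneg_left h3 (exp_pos (a * s)).le
    have h7 := mul_le_mul_of_nonneg_right (hE s hs) (mul_nonneg hC0 (hM0 s hs.1))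
    linarith
  have hpM : ∀ s ∈ Icc 0 t, p s ≤ 0 + (E * C * t) * ∫ u in (0 : ℝ)..s, p u := by
    intro s hs
    have hr : 0 ≤ (E * C * t) * ∫ u in (0 : ℝ)..s, p u :=
      mul_nonneg (mul_nonneg (mul_nonneg hE0 hC0) ht) (hM0 s hs.1)
    rw [zero_add]
    refine max_le hr ?_
    have h1 : ∫ r in (0 : ℝ)..s, -(E * (C * ∫ u in (0 : ℝ)..s, p u)) ≤ D s := by
      refine intervalIntegral.integral_mono_on hs.1 (by simp) (hd.intervalIntegrable _ _)
        fun r hrs => ?_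
      have h2 := hdlow r ⟨hrs.1, hrs.2.trans hs.2⟩
      have h3 := mul_le_mul_of_nonneg_left (hMmono s hs r hrs) (mul_nonneg hE0 hC0)
      linarith
    rw [intervalIntegral.integral_const, smul_eq_mul] at h1
    have h4 := mul_le_mul_of_nonneg_right hs.2 (mul_nonneg (mul_nonneg hE0 hC0) (hM0 s hs.1))
    linarith
  have hM := integral_le_of_le_add_mul_integral hpc continuous_zero (fun _ => le_rfl)
    (by positivity) hpM ⟨ht, le_rfl⟩
  simp only [Pi.zero_apply, intervalIntegral.integral_zero, mul_zero] at hM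
  have h1 := hpM t ⟨ht, le_rfl⟩
  have h2 : (E * C * t) * ∫ u in (0 : ℝ)..t, p u ≤ 0 :=
    mul_nonpos_of_nonneg_of_nonpos (by positivity) hM
  linarith [hpD t]

theorem volterra_forcing_le {d w f : ℝ → ℝ} {a : ℝ} (hd : Continuous d) (hw : Continuous w)
    (hw0 : ∀ t, 0 ≤ w t) (hf0 : 0 ≤ f 0) (hf : MonotoneOn f (Ici 0))
    (h : ∀ t, 0 ≤ t → d t = (∫ s in (0 : ℝ)..t, (a * d s + w s * ∫ u in (0 : ℝ)..s, d u)) + f t)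
    {t : ℝ} (ht : 0 ≤ t) : min 1 (exp (a * t)) * f t ≤ d t := by
  refine le_trans (le_add_of_nonneg_right ?_) (volterra_lower_bound hd hw hf0 hf h ht)
  refine mul_nonneg (exp_pos _).le (intervalIntegral.integral_nonneg ht fun s hs => ?_)
  exact mul_nonneg (exp_pos _).le
    (mul_nonneg (hw0 s) (volterra_integral_nonneg hd hw hw0 hf0 hf h hs.1))

theorem sq_intervalIntegral_abs_le {β : ℝ → ℝ} (hβ : Continuous β) {t : ℝ} (ht : 0 ≤ t) :
    (∫ s in (0 : ℝ)..t, |β s|) ^ 2 ≤ t * ∫ s in (0 : ℝ)..t, β s ^ 2 := by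
  rcases ht.eq_or_lt with rfl | ht0
  · simp
  set J := ∫ s in (0 : ℝ)..t, |β s| with hJ
  have h1 : 0 ≤ ∫ s in (0 : ℝ)..t, (β s ^ 2 - 2 * (J / t) * |β s| + (J / t) ^ 2) := by
    refine intervalIntegral.integral_nonneg ht fun s _ => ?_
    nlinarith [sq_nonneg (|β s| - J / t), sq_abs (β s)]
  rw [intervalIntegral.integral_add (by apply Continuous.intervalIntegrable; fun_prop)
    (by simp), intervalIntegral.integral_sub
    (by apply Continuous.intervalIntegrable; fun_prop)
    (by apply Continuous.intervalIntegrable; fun_prop), intervalIntegral.integral_const_mul,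
    intervalIntegral.integral_const, ← hJ, smul_eq_mul, sub_zero] at h1
  have h2 := mul_le_mul_of_nonneg_left h1 ht
  have h3 : t * ((∫ s in (0 : ℝ)..t, β s ^ 2) - 2 * (J / t) * J + t * (J / t) ^ 2)
      = t * (∫ s in (0 : ℝ)..t, β s ^ 2) - J ^ 2 := by
    field_simp
    ring
  rw [h3] at h2
  linarith

theorem exists_sq_le_of_volterra_eq {w : ℝ → ℝ} {b T : ℝ} (a σ c I : ℝ) (hw : Continuous w)
    (hw0 : ∀ t, 0 ≤ w t) (hwb : ∀ t, w t ≤ b) (hT : 0 ≤ T) :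
    ∃ K, ∀ x β : ℝ → ℝ, Continuous x → Continuous β →
      (∀ t ∈ Icc 0 T, x t = c + (∫ s in (0 : ℝ)..t,
        (a * x s + w s * (I + ∫ u in (0 : ℝ)..s, x u))) + σ * β t) →
      ∀ t ∈ Icc 0 T, x t ^ 2 ≤ K * (1 + β t ^ 2 + ∫ s in (0 : ℝ)..t, β s ^ 2) := by
  have hb : 0 ≤ b := (hw0 0).trans (hwb 0)
  set A := |c| + b * |I| * T with hA
  set L := |a| + b * T with hL
  have hA0 : 0 ≤ A := by positivity
  have hL0 : 0 ≤ L := by positivity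
  set A1 := A + L * (exp (L * T) * (A * T)) with hA1
  set M := L * (exp (L * T) * |σ|) with hM
  have hA10 : 0 ≤ A1 := by positivity
  have hM0 : 0 ≤ M := by positivity
  refine ⟨3 * (A1 ^ 2 + σ ^ 2 + M ^ 2 * T), fun x β hx hβ h t ht => ?_⟩
  have hI : ∀ s ∈ Icc 0 T, |x s| ≤ (A + |σ| * |β s|) + L * ∫ r in (0 : ℝ)..s, |x r| := by
    intro s hs
    have hpc : Continuous fun s => ∫ u in (0 : ℝ)..s, x u :=
      intervalIntegral.continuous_primitive (fun _ _ => hx.intervalIntegrable _ _) 0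
    have h1 : |∫ r in (0 : ℝ)..s, (a * x r + w r * (I + ∫ u in (0 : ℝ)..r, x u))|
        ≤ ∫ r in (0 : ℝ)..s, (|a| * |x r| + b * (|I| + ∫ u in (0 : ℝ)..s, |x u|)) := by
      refine (intervalIntegral.abs_integral_le_integral_abs hs.1).trans ?_
      refine intervalIntegral.integral_mono_on hs.1
        (by apply Continuous.intervalIntegrable; fun_prop)
        (by apply Continuous.intervalIntegrable; fun_prop) fun r hr => ?_
      refine (abs_add_le _ _).trans ?_
      rw [abs_mul, abs_mul, abs_of_nonneg (hw0 r)]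
      have h2 : |∫ u in (0 : ℝ)..r, x u| ≤ ∫ u in (0 : ℝ)..s, |x u| :=
        (intervalIntegral.abs_integral_le_integral_abs hr.1).trans
          (intervalIntegral.integral_mono_interval le_rfl hr.1 hr.2
            (ae_of_all _ fun _ => abs_nonneg _) (hx.abs.intervalIntegrable _ _))
      have h3 := (abs_add_le I (∫ u in (0 : ℝ)..r, x u)).trans (add_le_add_right h2 _)
      have := mul_le_mul (hwb r) h3 (abs_nonneg _) hb
      linarith
    have hR : ∫ r in (0 : ℝ)..s, (|a| * |x r| + b * (|I| + ∫ u in (0 : ℝ)..s, |x u|))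
        = |a| * (∫ r in (0 : ℝ)..s, |x r|) + s * (b * (|I| + ∫ u in (0 : ℝ)..s, |x u|)) := by
      rw [intervalIntegral.integral_add (by apply Continuous.intervalIntegrable; fun_prop)
        (by simp), intervalIntegral.integral_const_mul, intervalIntegral.integral_const,
        smul_eq_mul, sub_zero]
    rw [hR] at h1
    have h4 : 0 ≤ ∫ u in (0 : ℝ)..s, |x u| :=
      intervalIntegral.integral_nonneg hs.1 fun _ _ => abs_nonneg _
    have h5 : s * (b * (|I| + ∫ u in (0 : ℝ)..s, |x u|))
        ≤ T * (b * (|I| + ∫ u in (0 : ℝ)..s, |x u|)) :=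
      mul_le_mul_of_nonneg_right hs.2 (by positivity)
    rw [h s hs]
    have h6 := abs_add_le (c + ∫ r in (0 : ℝ)..s, (a * x r + w r * (I + ∫ u in (0 : ℝ)..r, x u)))
      (σ * β s)
    have h7 := abs_add_le c (∫ r in (0 : ℝ)..s, (a * x r + w r * (I + ∫ u in (0 : ℝ)..r, x u)))
    rw [abs_mul σ] at h6
    simp only [hA, hL]
    linarith
  have hG := integral_le_of_le_add_mul_integral hx.abs (g := fun s => A + |σ| * |β s|)
    (by fun_prop) (fun s => by positivity) hL0 hI ht
  rw [intervalIntegral.integral_add (by simp) (by apply Continuous.intervalIntegrable; fun_prop),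
    intervalIntegral.integral_const_mul, intervalIntegral.integral_const, smul_eq_mul,
    sub_zero] at hG
  have hQ := sq_intervalIntegral_abs_le hβ ht.1
  set J := ∫ s in (0 : ℝ)..t, |β s| with hJ
  set Q := ∫ s in (0 : ℝ)..t, β s ^ 2 with hQd
  have hJ0 : 0 ≤ J := intervalIntegral.integral_nonneg ht.1 fun _ _ => abs_nonneg _
  have hQ0 : 0 ≤ Q := intervalIntegral.integral_nonneg ht.1 fun _ _ => sq_nonneg _
  have hG' : exp (L * t) * (t * A + |σ| * J) ≤ exp (L * T) * (A * T + |σ| * J) := by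
    have : exp (L * t) ≤ exp (L * T) := exp_le_exp.2 (mul_le_mul_of_nonneg_left ht.2 hL0)
    have h2 : t * A + |σ| * J ≤ A * T + |σ| * J := by nlinarith [ht.2]
    have := ht.1
    gcongr
  have hxt : |x t| ≤ A1 + |σ| * |β t| + M * J := by
    have h1 := hI t ht
    have h2 := mul_le_mul_of_nonneg_left (hG.trans hG') hL0
    simp only [hA1, hM]
    linarith
  have hsq : x t ^ 2 ≤ (A1 + |σ| * |β t| + M * J) ^ 2 := by
    rw [← sq_abs]
    exact pow_le_pow_left₀ (abs_nonneg _) hxt 2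
  have h3 : (A1 + |σ| * |β t| + M * J) ^ 2
      ≤ 3 * (A1 ^ 2 + σ ^ 2 * β t ^ 2 + M ^ 2 * J ^ 2) := by
    rw [← sq_abs σ, ← sq_abs (β t)]
    nlinarith [sq_nonneg (A1 - |σ| * |β t|), sq_nonneg (A1 - M * J),
      sq_nonneg (|σ| * |β t| - M * J)]
  have h4 : M ^ 2 * J ^ 2 ≤ M ^ 2 * (T * Q) :=
    mul_le_mul_of_nonneg_left (hQ.trans (mul_le_mul_of_nonneg_right ht.2 hQ0)) (sq_nonneg _)
  have h5 : 0 ≤ A1 ^ 2 * (β t ^ 2 + Q) + σ ^ 2 * (1 + Q) + M ^ 2 * T * (1 + β t ^ 2) := by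
    positivity
  have h6 : 3 * (A1 ^ 2 + σ ^ 2 + M ^ 2 * T) * (1 + β t ^ 2 + Q)
      = 3 * (A1 ^ 2 + σ ^ 2 * β t ^ 2 + M ^ 2 * (T * Q))
        + 3 * (A1 ^ 2 * (β t ^ 2 + Q) + σ ^ 2 * (1 + Q) + M ^ 2 * T * (1 + β t ^ 2)) := by
    ring
  linarith

theorem measurable_intervalIntegral_of_continuous {Ω : Type*} [MeasurableSpace Ω]
    {V : ℝ → Ω → ℝ} (hc : ∀ ω, Continuous fun t => V t ω) (hm : ∀ t, Measurable (V t)) (r t : ℝ) :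
    Measurable fun ω => ∫ s in r..t, V s ω := by
  have hV : StronglyMeasurable (Function.uncurry V) :=
    (measurable_uncurry_of_continuous_of_measurable hc hm).stronglyMeasurable
  simp only [intervalIntegral]
  exact (hV.integral_prod_left (μ := volume.restrict (Ioc r t))).measurable.sub
    (hV.integral_prod_left (μ := volume.restrict (Ioc t r))).measurable

theorem integrable_uncurry_of_integral_abs_le {Ω : Type*} [MeasurableSpace Ω] {P : Measure Ω}
    [IsProbabilityMeasure P] {V : ℝ → Ω → ℝ} (hc : ∀ ω, Continuous fun t => V t ω)
    (hm : ∀ t, Measurable (V t)) {K t : ℝ}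
    (hK : ∀ s ∈ Icc 0 t, Integrable (V s) P ∧ ∫ ω, |V s ω| ∂P ≤ K) :
    Integrable (Function.uncurry V) ((volume.restrict (Ioc 0 t)).prod P) := by
  have hV : StronglyMeasurable (Function.uncurry V) :=
    (measurable_uncurry_of_continuous_of_measurable hc hm).stronglyMeasurable
  refine (integrable_prod_iff hV.aestronglyMeasurable).2 ⟨?_, ?_⟩
  · filter_upwards [ae_restrict_mem measurableSet_Ioc] with s hs
    exact (hK s (Ioc_subset_Icc_self hs)).1
  · refine Integrable.of_bound hV.norm.integral_prod_right'.aestronglyMeasurable K ?_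
    filter_upwards [ae_restrict_mem measurableSet_Ioc] with s hs
    rw [norm_of_nonneg (integral_nonneg fun _ => norm_nonneg _)]
    exact (hK s (Ioc_subset_Icc_self hs)).2

theorem integral_intervalIntegral_of_integral_abs_le {Ω : Type*} [MeasurableSpace Ω]
    {P : Measure Ω} [IsProbabilityMeasure P] {V : ℝ → Ω → ℝ}
    (hc : ∀ ω, Continuous fun t => V t ω) (hm : ∀ t, Measurable (V t)) {K t : ℝ} (ht : 0 ≤ t)
    (hK : ∀ s ∈ Icc 0 t, Integrable (V s) P ∧ ∫ ω, |V s ω| ∂P ≤ K) :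
    Integrable (fun ω => ∫ s in (0 : ℝ)..t, V s ω) P ∧
      ∫ ω, |∫ s in (0 : ℝ)..t, V s ω| ∂P ≤ t * K ∧
      IntervalIntegrable (fun s => ∫ ω, V s ω ∂P) volume 0 t ∧
      ∫ ω, (∫ s in (0 : ℝ)..t, V s ω) ∂P = ∫ s in (0 : ℝ)..t, ∫ ω, V s ω ∂P := by
  have hi := integrable_uncurry_of_integral_abs_le hc hm hK
  have hia : Integrable (Function.uncurry fun s ω => |V s ω|)
      ((volume.restrict (uIoc 0 t)).prod P) := by
    rw [uIoc_of_le ht]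
    exact hi.abs
  have hswap := intervalIntegral_integral_swap hia
  have h1 : Integrable (fun ω => ∫ s in (0 : ℝ)..t, V s ω) P := by
    simp only [intervalIntegral.integral_of_le ht]
    exact hi.integral_prod_right
  have h2 : Integrable (fun ω => ∫ s in (0 : ℝ)..t, |V s ω|) P := by
    simp only [intervalIntegral.integral_of_le ht]
    exact hi.abs.integral_prod_right
  have h3 : IntervalIntegrable (fun s => ∫ ω, |V s ω| ∂P) volume 0 t := by
    rw [intervalIntegrable_iff_integrableOn_Ioc_of_le ht]
    exact hi.abs.integral_prod_left
  refine ⟨h1, ?_, ?_, ?_⟩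
  · calc ∫ ω, |∫ s in (0 : ℝ)..t, V s ω| ∂P ≤ ∫ ω, (∫ s in (0 : ℝ)..t, |V s ω|) ∂P :=
          integral_mono h1.abs h2 fun ω => intervalIntegral.abs_integral_le_integral_abs ht
      _ = ∫ s in (0 : ℝ)..t, ∫ ω, |V s ω| ∂P := hswap.symm
      _ ≤ ∫ s in (0 : ℝ)..t, K :=
          intervalIntegral.integral_mono_on ht h3 (by simp) fun s hs => (hK s hs).2
      _ = t * K := by simp
  · rw [intervalIntegrable_iff_integrableOn_Ioc_of_le ht]
    exact hi.integral_prod_left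
  · symm
    apply intervalIntegral_integral_swap
    rw [uIoc_of_le ht]
    exact hi
namespace IsStdBrownian

variable {Ω : Type*} {mΩ : MeasurableSpace Ω} {P : Measure Ω} {F : MeasureTheory.Filtration ℝ mΩ}
  {B : ℝ → Ω → ℝ}

theorem measurable (hB : IsStdBrownian P F B) (t : ℝ) : Measurable (B t) :=
  (hB.1 t).mono (F.le t) le_rfl

theorem continuous_path (hB : IsStdBrownian P F B) (ω : Ω) : Continuous fun t => B t ω :=
  hB.2.2.1 ω

theorem hasLaw_increment (hB : IsStdBrownian P F B) {s t : ℝ} (hs : 0 ≤ s) (hst : s ≤ t) :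
    HasLaw (fun ω => B t ω - B s ω) (gaussianReal 0 (Real.toNNReal (t - s))) P :=
  ⟨((hB.measurable t).sub (hB.measurable s)).aemeasurable, hB.2.2.2.1 s t hs hst⟩

theorem memLp_increment (hB : IsStdBrownian P F B) {s t : ℝ} (hs : 0 ≤ s) (hst : s ≤ t) :
    MemLp (fun ω => B t ω - B s ω) 2 P := by
  have h := hB.hasLaw_increment hs hst
  have h2 : MemLp id 2 (P.map fun ω => B t ω - B s ω) := by
    rw [h.map_eq]
    exact memLp_id_gaussianReal 2
  exact h2.comp_of_map h.aemeasurable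

theorem integral_increment (hB : IsStdBrownian P F B) {s t : ℝ} (hs : 0 ≤ s) (hst : s ≤ t) :
    ∫ ω, (B t ω - B s ω) ∂P = 0 := by
  rw [(hB.hasLaw_increment hs hst).integral_eq, integral_id_gaussianReal]

theorem integral_increment_sq [IsProbabilityMeasure P] (hB : IsStdBrownian P F B) {s t : ℝ}
    (hs : 0 ≤ s) (hst : s ≤ t) : ∫ ω, (B t ω - B s ω) ^ 2 ∂P = t - s := by
  have h := (hB.hasLaw_increment hs hst).variance_eq
  rw [variance_eq_sub (hB.memLp_increment hs hst), hB.integral_increment hs hst,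
    variance_id_gaussianReal, Real.coe_toNNReal _ (sub_nonneg.2 hst)] at h
  simpa using h

theorem memLp (hB : IsStdBrownian P F B) {t : ℝ} (ht : 0 ≤ t) : MemLp (B t) 2 P := by
  simpa [hB.2.1] using hB.memLp_increment le_rfl ht

theorem integral_eq_zero (hB : IsStdBrownian P F B) {t : ℝ} (ht : 0 ≤ t) :
    ∫ ω, B t ω ∂P = 0 := by
  simpa [hB.2.1] using hB.integral_increment le_rfl ht

theorem integral_sq [IsProbabilityMeasure P] (hB : IsStdBrownian P F B) {t : ℝ} (ht : 0 ≤ t) :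
    ∫ ω, B t ω ^ 2 ∂P = t := by
  simpa [hB.2.1] using hB.integral_increment_sq le_rfl ht

theorem integral_mul_of_le [IsProbabilityMeasure P] (hB : IsStdBrownian P F B) {s t : ℝ}
    (hs : 0 ≤ s) (hst : s ≤ t) : ∫ ω, B s ω * B t ω ∂P = s := by
  have hind : IndepFun (fun ω => B t ω - B s ω) (B s) P := by
    rw [IndepFun_iff_Indep]
    exact indep_of_indep_of_le_right (hB.2.2.2.2 s t hs hst) (hB.1 s).comap_le
  have h0 := hind.integral_fun_mul_eq_mul_integral
    ((hB.measurable t).sub (hB.measurable s)).aestronglyMeasurable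
    (hB.measurable s).aestronglyMeasurable
  rw [hB.integral_increment hs hst, zero_mul] at h0
  have h1 : Integrable (fun ω => (B t ω - B s ω) * B s ω) P :=
    (hB.memLp_increment hs hst).integrable_mul (hB.memLp hs)
  have h2 : Integrable (fun ω => B s ω ^ 2) P := (hB.memLp hs).integrable_sq
  calc ∫ ω, B s ω * B t ω ∂P = ∫ ω, ((B t ω - B s ω) * B s ω + B s ω ^ 2) ∂P := by
        congr 1 with ω
        ring
    _ = s := by rw [integral_add h1 h2, h0, hB.integral_sq hs, zero_add]

theorem integral_mul [IsProbabilityMeasure P] (hB : IsStdBrownian P F B) {s t : ℝ}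
    (hs : 0 ≤ s) (ht : 0 ≤ t) : ∫ ω, B s ω * B t ω ∂P = min s t := by
  rcases le_total s t with hst | hst
  · rw [hB.integral_mul_of_le hs hst, min_eq_left hst]
  · simp_rw [mul_comm (B s _)]
    rw [hB.integral_mul_of_le ht hst, min_eq_right hst]

theorem integral_mul_increment [IsProbabilityMeasure P] (hB : IsStdBrownian P F B) {s t u : ℝ}
    (hs : 0 ≤ s) (ht : 0 ≤ t) (hu : 0 ≤ u) :
    ∫ ω, B u ω * (B t ω - B s ω) ∂P = min u t - min u s := by
  have h1 : Integrable (fun ω => B u ω * B t ω) P := (hB.memLp hu).integrable_mul (hB.memLp ht)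
  have h2 : Integrable (fun ω => B u ω * B s ω) P := (hB.memLp hu).integrable_mul (hB.memLp hs)
  simp_rw [mul_sub]
  rw [integral_sub h1 h2, hB.integral_mul hu ht, hB.integral_mul hu hs]

theorem continuousOn_integral_mul [IsProbabilityMeasure P] (hB : IsStdBrownian P F B)
    {Z : Ω → ℝ} (hZ : MemLp Z 2 P) : ContinuousOn (fun t => ∫ ω, B t ω * Z ω ∂P) (Ici 0) := by
  set C := 1 + ∫ ω, Z ω ^ 2 ∂P with hC
  have hC0 : 0 ≤ C := add_nonneg zero_le_one (integral_nonneg fun _ => sq_nonneg _)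
  have hle : ∀ s t : ℝ, 0 ≤ s → s ≤ t →
      |(∫ ω, B t ω * Z ω ∂P) - ∫ ω, B s ω * Z ω ∂P| ≤ √|t - s| * C := by
    intro s t hs hst
    rcases hst.eq_or_lt with rfl | hlt
    · simp
    set r := √|t - s| with hr
    have hr0 : 0 < r := Real.sqrt_pos.2 (abs_pos.2 (sub_pos.2 hlt).ne')
    have hr2 : r ^ 2 = t - s := by
      rw [hr, Real.sq_sqrt (abs_nonneg _), abs_of_pos (sub_pos.2 hlt)]
    have hI := hB.memLp_increment hs hst
    have ht : Integrable (fun ω => B t ω * Z ω) P :=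
      (hB.memLp (hs.trans hst)).integrable_mul hZ
    have hs' : Integrable (fun ω => B s ω * Z ω) P := (hB.memLp hs).integrable_mul hZ
    rw [← integral_sub ht hs']
    calc |∫ ω, (B t ω * Z ω - B s ω * Z ω) ∂P|
        ≤ ∫ ω, |B t ω * Z ω - B s ω * Z ω| ∂P := abs_integral_le_integral_abs
      _ ≤ ∫ ω, (r⁻¹ * (B t ω - B s ω) ^ 2 + r * Z ω ^ 2) ∂P := by
          refine integral_mono (ht.sub hs').abs
            ((hI.integrable_sq.const_mul _).add (hZ.integrable_sq.const_mul _)) fun ω => ?_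
          have h1 : r⁻¹ * (B t ω - B s ω) ^ 2 + r * Z ω ^ 2
              = r⁻¹ * (|B t ω - B s ω| - r * |Z ω|) ^ 2 + 2 * (|B t ω - B s ω| * |Z ω|) := by
            rw [← sq_abs (B t ω - B s ω), ← sq_abs (Z ω)]
            field_simp
            ring
          rw [h1, ← sub_mul, abs_mul]
          have : 0 ≤ |B t ω - B s ω| * |Z ω| := by positivity
          have : 0 ≤ r⁻¹ * (|B t ω - B s ω| - r * |Z ω|) ^ 2 := by positivity
          linarith
      _ = r * C := by
          rw [integral_add (hI.integrable_sq.const_mul _) (hZ.integrable_sq.const_mul _),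
            integral_const_mul, integral_const_mul, hB.integral_increment_sq hs hst, ← hr2, hC]
          field_simp
  intro s hs
  have hlim : Tendsto (fun t : ℝ => √|t - s| * C) (nhdsWithin s (Ici 0)) (nhds 0) := by
    have : Continuous fun t : ℝ => √|t - s| * C := by fun_prop
    simpa using (this.tendsto s).mono_left nhdsWithin_le_nhds
  refine tendsto_iff_norm_sub_tendsto_zero.2 (squeeze_zero' (Eventually.of_forall fun _ =>
    norm_nonneg _) ?_ hlim)
  filter_upwards [self_mem_nhdsWithin] with t ht
  rw [Real.norm_eq_abs]
  rcases le_total s t with hst | hst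
  · exact hle s t hs hst
  · rw [abs_sub_comm, abs_sub_comm t]
    exact hle t s ht hst

end IsStdBrownian

namespace IsSolutionSFDE

variable {Ω : Type*} {mΩ : MeasurableSpace Ω} {P : Measure Ω} {F : MeasureTheory.Filtration ℝ mΩ}
  {a b σ : ℝ} {ψ : ℝ → ℝ} {B X : ℝ → Ω → ℝ}

theorem measurable (hX : IsSolutionSFDE P F a b σ ψ B X) {t : ℝ} (ht : 0 ≤ t) :
    Measurable (X t) :=
  ((hX.1 t ht).mono (F.le t)).measurable

theorem continuous_clamp (hX : IsSolutionSFDE P F a b σ ψ B X) (ω : Ω) :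
    Continuous fun t => X (max t 0) ω :=
  (hX.2.1 ω).comp_continuous (by fun_prop) fun t => le_max_right t 0

theorem ae_clamp_eq (hX : IsSolutionSFDE P F a b σ ψ B X) : ∀ᵐ ω ∂P, ∀ t : ℝ, 0 ≤ t →
    X (max t 0) ω = ψ 0 + (∫ s in (0 : ℝ)..t, (a * X (max s 0) ω + b / (1 + max s 0) *
      ((∫ u in (-1 : ℝ)..(0 : ℝ), ψ u) + ∫ u in (0 : ℝ)..s, X (max u 0) ω))) + σ * B t ω := by
  filter_upwards [hX.2.2] with ω hω t ht
  rw [max_eq_left ht, hω t ht]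
  congr 2
  refine intervalIntegral.integral_congr fun s hs => ?_
  rw [uIcc_of_le ht] at hs
  simp only [max_eq_left hs.1]
  congr 3
  refine intervalIntegral.integral_congr fun u hu => ?_
  rw [uIcc_of_le hs.1] at hu
  simp only [max_eq_left hu.1]

theorem exists_memLp_and_integral_sq_le [IsProbabilityMeasure P]
    (hX : IsSolutionSFDE P F a b σ ψ B X) (hB : IsStdBrownian P F B) (hb : 0 ≤ b) {T : ℝ}
    (hT : 0 ≤ T) : ∃ K, ∀ t ∈ Icc 0 T, MemLp (X t) 2 P ∧ ∫ ω, X t ω ^ 2 ∂P ≤ K := by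
  have hpos : ∀ s : ℝ, 0 < 1 + max s 0 := fun s =>
    add_pos_of_pos_of_nonneg one_pos (le_max_right _ _)
  obtain ⟨K, hK⟩ := exists_sq_le_of_volterra_eq (w := fun s => b / (1 + max s 0)) (b := b) a σ
    (ψ 0) (∫ u in (-1 : ℝ)..(0 : ℝ), ψ u)
    (continuous_const.div (by fun_prop) fun s => (hpos s).ne')
    (fun s => div_nonneg hb (hpos s).le)
    (fun s => div_le_self hb (le_add_of_nonneg_right (le_max_right _ _))) hT
  refine ⟨|K| * (1 + T + T * T), fun t ht => ?_⟩
  have hQ := integral_intervalIntegral_of_integral_abs_le (P := P) (K := T) (t := t)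
    (V := fun s ω => B (max s 0) ω ^ 2)
    (fun ω => ((hB.continuous_path ω).comp (by fun_prop : Continuous fun t : ℝ => max t 0)).pow 2)
    (fun s => (hB.measurable _).pow_const 2) ht.1 fun s hs => by
      simp only [max_eq_left hs.1, abs_sq]
      exact ⟨(hB.memLp hs.1).integrable_sq, (hB.integral_sq hs.1).trans_le (hs.2.trans ht.2)⟩
  have hQ0 : ∀ ω, 0 ≤ ∫ s in (0 : ℝ)..t, B (max s 0) ω ^ 2 := fun ω =>
    intervalIntegral.integral_nonneg ht.1 fun _ _ => sq_nonneg _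
  have hQK := hQ.2.1
  simp only [abs_of_nonneg (hQ0 _)] at hQK
  have hB2 : Integrable (fun ω => B t ω ^ 2) P := (hB.memLp ht.1).integrable_sq
  have hOneAdd : Integrable (fun ω => 1 + B t ω ^ 2) P := (integrable_const 1).add hB2
  have hdom : Integrable
      (fun ω => |K| * (1 + B t ω ^ 2 + ∫ s in (0 : ℝ)..t, B (max s 0) ω ^ 2)) P :=
    (hOneAdd.add hQ.1).const_mul |K|
  have hle : ∀ᵐ ω ∂P, X t ω ^ 2
      ≤ |K| * (1 + B t ω ^ 2 + ∫ s in (0 : ℝ)..t, B (max s 0) ω ^ 2) := by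
    filter_upwards [hX.ae_clamp_eq] with ω hω
    have h := hK (fun t => X (max t 0) ω) (fun t => B (max t 0) ω) (hX.continuous_clamp ω)
      ((hB.continuous_path ω).comp (by fun_prop))
      (fun s hs => (hω s hs.1).trans (by simp only [max_eq_left hs.1])) t ht
    simp only [max_eq_left ht.1] at h
    exact h.trans (mul_le_mul_of_nonneg_right (le_abs_self K)
      (add_nonneg (add_nonneg zero_le_one (sq_nonneg _)) (hQ0 ω)))
  have hXm := hX.measurable ht.1
  have hX2 : Integrable (fun ω => X t ω ^ 2) P := by
    refine hdom.mono' (hXm.pow_const 2).aestronglyMeasurable ?_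
    filter_upwards [hle] with ω hω
    rwa [norm_of_nonneg (sq_nonneg _)]
  refine ⟨(memLp_two_iff_integrable_sq hXm.aestronglyMeasurable).2 hX2, ?_⟩
  refine (integral_mono_ae hX2 hdom hle).trans ?_
  rw [integral_const_mul, integral_add hOneAdd hQ.1, integral_add (integrable_const 1) hB2,
    hB.integral_sq ht.1]
  simp only [integral_const, probReal_univ, smul_eq_mul, mul_one]
  refine mul_le_mul_of_nonneg_left ?_ (abs_nonneg K)
  nlinarith [ht.1, ht.2]

theorem memLp [IsProbabilityMeasure P] (hX : IsSolutionSFDE P F a b σ ψ B X)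
    (hB : IsStdBrownian P F B) (hb : 0 ≤ b) {t : ℝ} (ht : 0 ≤ t) : MemLp (X t) 2 P := by
  obtain ⟨K, hK⟩ := hX.exists_memLp_and_integral_sq_le hB hb ht
  exact (hK t ⟨ht, le_rfl⟩).1

theorem integral_mul_eq [IsProbabilityMeasure P] (hX : IsSolutionSFDE P F a b σ ψ B X)
    (hB : IsStdBrownian P F B) (hb : 0 ≤ b) {Z : Ω → ℝ} (hZm : Measurable Z)
    (hZ : MemLp Z 2 P) (hZ0 : ∫ ω, Z ω ∂P = 0) {t : ℝ} (ht : 0 ≤ t) :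
    IntervalIntegrable (fun s => a * (∫ ω, X (max s 0) ω * Z ω ∂P) + b / (1 + max s 0) *
        ∫ u in (0 : ℝ)..s, ∫ ω, X (max u 0) ω * Z ω ∂P) volume 0 t ∧
      ∫ ω, X (max t 0) ω * Z ω ∂P
        = (∫ s in (0 : ℝ)..t, (a * (∫ ω, X (max s 0) ω * Z ω ∂P) + b / (1 + max s 0) *
            ∫ u in (0 : ℝ)..s, ∫ ω, X (max u 0) ω * Z ω ∂P)) + σ * ∫ ω, B t ω * Z ω ∂P := by
  have hpos : ∀ s : ℝ, 0 < 1 + max s 0 := fun s =>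
    add_pos_of_pos_of_nonneg one_pos (le_max_right _ _)
  set w : ℝ → ℝ := fun s => b / (1 + max s 0) with hw
  have hwc : Continuous w := continuous_const.div (by fun_prop) fun s => (hpos s).ne'
  have hw0 : ∀ s, 0 ≤ w s := fun s => div_nonneg hb (hpos s).le
  have hwb : ∀ s, w s ≤ b := fun s =>
    div_le_self hb (le_add_of_nonneg_right (le_max_right _ _))
  set I := ∫ u in (-1 : ℝ)..(0 : ℝ), ψ u with hI
  set Y : ℝ → Ω → ℝ := fun s ω => X (max s 0) ω * Z ω with hY
  have hYc : ∀ ω, Continuous fun s => Y s ω := fun ω => (hX.continuous_clamp ω).mul_const _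
  have hYm : ∀ s, Measurable (Y s) := fun s => (hX.measurable (le_max_right s 0)).mul hZm
  have hZi : Integrable Z P := hZ.integrable one_le_two
  obtain ⟨K, hK⟩ := hX.exists_memLp_and_integral_sq_le hB hb ht
  set K' := K + ∫ ω, Z ω ^ 2 ∂P with hK'
  have hYK : ∀ s ∈ Icc 0 t, Integrable (Y s) P ∧ ∫ ω, |Y s ω| ∂P ≤ K' := by
    intro s hs
    obtain ⟨hXs, hXK⟩ := hK s hs
    have hYi : Integrable (Y s) P := by
      simp only [hY, max_eq_left hs.1]
      exact hXs.integrable_mul hZ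
    refine ⟨hYi, ?_⟩
    calc ∫ ω, |Y s ω| ∂P ≤ ∫ ω, (X s ω ^ 2 + Z ω ^ 2) ∂P := by
          refine integral_mono hYi.abs (hXs.integrable_sq.add hZ.integrable_sq) fun ω => ?_
          simp only [hY, max_eq_left hs.1, abs_mul]
          nlinarith [sq_nonneg (|X s ω| - |Z ω|), sq_abs (X s ω), sq_abs (Z ω),
            sq_nonneg (X s ω), sq_nonneg (Z ω)]
      _ ≤ K' := by
          rw [integral_add hXs.integrable_sq hZ.integrable_sq]
          exact add_le_add_left hXK _
  have hYI := fun s (hs : s ∈ Icc 0 t) =>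
    integral_intervalIntegral_of_integral_abs_le hYc hYm hs.1
      fun r hr => hYK r ⟨hr.1, hr.2.trans hs.2⟩
  have hK'0 : 0 ≤ K' :=
    (integral_nonneg fun _ => abs_nonneg _).trans (hYK 0 ⟨le_rfl, ht⟩).2
  set V : ℝ → Ω → ℝ := fun s ω => a * Y s ω + w s * (I * Z ω + ∫ u in (0 : ℝ)..s, Y u ω) with hV
  have hVc : ∀ ω, Continuous fun s => V s ω := fun ω => by
    have := intervalIntegral.continuous_primitive
      (fun _ _ => (hYc ω).intervalIntegrable (μ := volume) _ _) 0
    have := hYc ω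
    fun_prop
  have hVm : ∀ s, Measurable (V s) := fun s =>
    ((hYm s).const_mul a).add (((hZm.const_mul I).add
      (measurable_intervalIntegral_of_continuous hYc hYm 0 s)).const_mul (w s))
  have hVi : ∀ s ∈ Icc 0 t, Integrable (fun ω => I * Z ω + ∫ u in (0 : ℝ)..s, Y u ω) P :=
    fun s hs => (hZi.const_mul I).add (hYI s hs).1
  have hVK : ∀ s ∈ Icc 0 t, Integrable (V s) P ∧ ∫ ω, |V s ω| ∂P
      ≤ |a| * K' + b * (|I| * (∫ ω, |Z ω| ∂P) + t * K') := by
    intro s hs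
    obtain ⟨h1, h2, -, -⟩ := hYI s hs
    have hYs := hYK s hs
    have hVs : Integrable (V s) P := (hYs.1.const_mul a).add ((hVi s hs).const_mul (w s))
    have i1 : Integrable (fun ω => |a| * |Y s ω|) P := hYs.1.abs.const_mul _
    have i2 : Integrable (fun ω => |I| * |Z ω|) P := hZi.abs.const_mul _
    have i3 : Integrable (fun ω => |I| * |Z ω| + |∫ u in (0 : ℝ)..s, Y u ω|) P := i2.add h1.abs
    refine ⟨hVs, ?_⟩
    calc ∫ ω, |V s ω| ∂P
        ≤ ∫ ω, (|a| * |Y s ω| + b * (|I| * |Z ω| + |∫ u in (0 : ℝ)..s, Y u ω|)) ∂P := by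
          refine integral_mono hVs.abs (i1.add (i3.const_mul b)) fun ω => ?_
          refine (abs_add_le _ _).trans ?_
          rw [abs_mul a, abs_mul (w s), abs_of_nonneg (hw0 s)]
          have h3 := abs_add_le (I * Z ω) (∫ u in (0 : ℝ)..s, Y u ω)
          rw [abs_mul I] at h3
          exact add_le_add_right (mul_le_mul (hwb s) h3 (abs_nonneg _) hb) _
      _ = |a| * (∫ ω, |Y s ω| ∂P) + b * (|I| * (∫ ω, |Z ω| ∂P)
            + ∫ ω, |∫ u in (0 : ℝ)..s, Y u ω| ∂P) := by
          rw [integral_add i1 (i3.const_mul b), integral_const_mul, integral_const_mul,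
            integral_add i2 h1.abs, integral_const_mul]
      _ ≤ _ := by
          have := hYs.2
          have := h2.trans (mul_le_mul_of_nonneg_right hs.2 hK'0)
          gcongr
  obtain ⟨hVI, -, hVint, hVswap⟩ := integral_intervalIntegral_of_integral_abs_le hVc hVm ht hVK
  have hEV : ∀ s ∈ Icc 0 t, ∫ ω, V s ω ∂P
      = a * (∫ ω, Y s ω ∂P) + w s * ∫ u in (0 : ℝ)..s, ∫ ω, Y u ω ∂P := by
    intro s hs
    simp only [hV]
    rw [integral_add ((hYK s hs).1.const_mul a) ((hVi s hs).const_mul (w s)),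
      integral_const_mul, integral_const_mul, integral_add (hZi.const_mul I) (hYI s hs).1,
      integral_const_mul, hZ0, mul_zero, zero_add, (hYI s hs).2.2.2]
  have hBZ : Integrable (fun ω => B t ω * Z ω) P := (hB.memLp ht).integrable_mul hZ
  refine ⟨hVint.congr fun s hs => ?_, ?_⟩
  · rw [uIoc_of_le ht] at hs
    exact hEV s (Ioc_subset_Icc_self hs)
  · have hpath : ∀ᵐ ω ∂P, Y t ω
        = ψ 0 * Z ω + (∫ s in (0 : ℝ)..t, V s ω) + σ * (B t ω * Z ω) := by
      filter_upwards [hX.ae_clamp_eq] with ω hω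
      have hVe : ∀ s, V s ω = (a * X (max s 0) ω
          + w s * (I + ∫ u in (0 : ℝ)..s, X (max u 0) ω)) * Z ω := by
        intro s
        simp only [hV, hY, intervalIntegral.integral_mul_const]
        ring
      simp only [hVe, intervalIntegral.integral_mul_const]
      simp only [hY, hω t ht]
      ring
    have i1 : Integrable (fun ω => ψ 0 * Z ω + ∫ s in (0 : ℝ)..t, V s ω) P :=
      (hZi.const_mul _).add hVI
    rw [integral_congr_ae hpath, integral_add i1 (hBZ.const_mul σ),
      integral_add (hZi.const_mul _) hVI, integral_const_mul, integral_const_mul, hZ0, mul_zero,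
      zero_add, hVswap]
    congr 1
    refine intervalIntegral.integral_congr fun s hs => ?_
    rw [uIcc_of_le ht] at hs
    exact hEV s hs

theorem continuous_integral_mul [IsProbabilityMeasure P] (hX : IsSolutionSFDE P F a b σ ψ B X)
    (hB : IsStdBrownian P F B) (hb : 0 ≤ b) {Z : Ω → ℝ} (hZm : Measurable Z)
    (hZ : MemLp Z 2 P) (hZ0 : ∫ ω, Z ω ∂P = 0) :
    Continuous fun t => ∫ ω, X (max t 0) ω * Z ω ∂P := by
  have hon : ContinuousOn (fun t => ∫ ω, X (max t 0) ω * Z ω ∂P) (Ici 0) := by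
    intro t (ht : 0 ≤ t)
    have ht1 : 0 ≤ t + 1 := by linarith
    have hint := (intervalIntegrable_iff_integrableOn_Icc_of_le ht1).1
      (hX.integral_mul_eq hB hb hZm hZ hZ0 ht1).1
    rw [← uIcc_of_le ht1] at hint
    have hc := intervalIntegral.continuousOn_primitive_interval hint
    rw [uIcc_of_le ht1] at hc
    have hc2 := hc.add (((hB.continuousOn_integral_mul hZ).mono Icc_subset_Ici_self).const_mul σ)
    refine ((hc2.congr fun s hs => (hX.integral_mul_eq hB hb hZm hZ hZ0 hs.1).2)
      t ⟨ht, by linarith⟩).mono_of_mem_nhdsWithin ?_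
    rw [← Ici_inter_Iic]
    exact inter_mem self_mem_nhdsWithin (mem_nhdsWithin_of_mem_nhds (Iic_mem_nhds (by linarith)))
  simpa [Function.comp_def] using hon.comp_continuous (f := fun t : ℝ => max t 0) (by fun_prop)
    fun t => le_max_right t 0

theorem forcing_le_integral_mul [IsProbabilityMeasure P]
    (hX : IsSolutionSFDE P F a b σ ψ B X) (hB : IsStdBrownian P F B) (hb : 0 ≤ b) (hσ : 0 ≤ σ)
    {Z : Ω → ℝ} (hZm : Measurable Z) (hZ : MemLp Z 2 P) (hZ0 : ∫ ω, Z ω ∂P = 0)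
    (hmono : MonotoneOn (fun t => ∫ ω, B t ω * Z ω ∂P) (Ici 0)) {t : ℝ} (ht : 0 ≤ t) :
    min 1 (exp (a * t)) * (σ * ∫ ω, B t ω * Z ω ∂P) ≤ ∫ ω, X t ω * Z ω ∂P := by
  have hpos : ∀ s : ℝ, 0 < 1 + max s 0 := fun s =>
    add_pos_of_pos_of_nonneg one_pos (le_max_right _ _)
  have h := volterra_forcing_le (a := a) (w := fun s => b / (1 + max s 0))
    (f := fun t => σ * ∫ ω, B t ω * Z ω ∂P)
    (hX.continuous_integral_mul hB hb hZm hZ hZ0)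
    (continuous_const.div (by fun_prop) fun s => (hpos s).ne')
    (fun s => div_nonneg hb (hpos s).le) (by simp [hB.2.1])
    (fun s hs u hu hsu => mul_le_mul_of_nonneg_left (hmono hs hu hsu) hσ)
    (fun s hs => (hX.integral_mul_eq hB hb hZm hZ hZ0 hs).2) ht
  simpa only [max_eq_left ht] using h

theorem forcing_le_integral_mul_increment [IsProbabilityMeasure P]
    (hX : IsSolutionSFDE P F a b σ ψ B X) (hB : IsStdBrownian P F B) (hb : 0 ≤ b) (hσ : 0 ≤ σ)
    {r s t : ℝ} (hr : 0 ≤ r) (hrs : r ≤ s) (ht : 0 ≤ t) :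
    min 1 (exp (a * t)) * (σ * (min t s - min t r))
      ≤ ∫ ω, X t ω * (B s ω - B r ω) ∂P := by
  have hs := hr.trans hrs
  rw [← hB.integral_mul_increment hr hs ht]
  refine hX.forcing_le_integral_mul hB hb hσ (Z := fun ω => B s ω - B r ω)
    ((hB.measurable s).sub (hB.measurable r))
    (hB.memLp_increment hr hrs) (hB.integral_increment hr hrs) (fun u hu v hv huv => ?_) ht
  simp only [hB.integral_mul_increment hr hs hu, hB.integral_mul_increment hr hs hv]
  rcases le_total u s with h1 | h1 <;> rcases le_total u r with h2 | h2 <;>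
    rcases le_total v s with h3 | h3 <;> rcases le_total v r with h4 | h4 <;>
    simp only [min_eq_left, min_eq_right, h1, h2, h3, h4] <;> linarith

end IsSolutionSFDE

theorem sfde_autocovariance_pos {Ω : Type*} {mΩ : MeasurableSpace Ω} (P : Measure Ω) [IsProbabilityMeasure P]
    (F : MeasureTheory.Filtration ℝ mΩ) (a b σ : ℝ) (ψ : ℝ → ℝ) (B X : ℝ → Ω → ℝ)
    (hσ : 0 < σ) (hψ : ContinuousOn ψ (Set.Icc (-1 : ℝ) 0))
    (hB : IsStdBrownian P F B) (hX : IsSolutionSFDE P F a b σ ψ B X)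
    (hb : 0 < b) :
    ∀ t : ℝ, 0 < t → ∀ Δ : ℝ, 0 ≤ Δ → 0 < rcov P (X t) (X (t + Δ)) := by
  intro t ht Δ hΔ
  have hu : 0 < t + Δ := by linarith
  have hXt := hX.memLp hB hb.le ht.le
  have hXu := hX.memLp hB hb.le hu.le
  set m := ∫ ω, X t ω ∂P with hm
  have hZ0 : ∫ ω, (X t ω - m) ∂P = 0 := by
    rw [integral_sub (hXt.integrable one_le_two) (integrable_const m)]
    simp [hm]
  have hZ : MemLp (fun ω => X t ω - m) 2 P := hXt.sub (memLp_const m)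
  have hBZ : ∀ s, 0 ≤ s → ∫ ω, B s ω * (X t ω - m) ∂P = ∫ ω, X t ω * B s ω ∂P := by
    intro s hs
    have h1 : Integrable (fun ω => X t ω * B s ω) P := hXt.integrable_mul (hB.memLp hs)
    have h2 : Integrable (fun ω => m * B s ω) P :=
      ((hB.memLp hs).integrable one_le_two).const_mul m
    simp_rw [mul_comm (B s _), sub_mul]
    rw [integral_sub h1 h2, integral_const_mul, hB.integral_eq_zero hs, mul_zero, sub_zero]
  have hmono : MonotoneOn (fun s => ∫ ω, B s ω * (X t ω - m) ∂P) (Ici 0) := by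
    intro r (hr : 0 ≤ r) s (hs : 0 ≤ s) hrs
    have h1 : Integrable (fun ω => X t ω * B s ω) P := hXt.integrable_mul (hB.memLp hs)
    have h2 : Integrable (fun ω => X t ω * B r ω) P := hXt.integrable_mul (hB.memLp hr)
    simp only [hBZ r hr, hBZ s hs]
    rw [← sub_nonneg, ← integral_sub h1 h2]
    simp_rw [← mul_sub]
    refine le_trans ?_ (hX.forcing_le_integral_mul_increment hB hb.le hσ.le hr hrs ht.le)
    have : 0 ≤ min t s - min t r := sub_nonneg.2 (min_le_min_left t hrs)
    positivity
  have hforce : 0 < ∫ ω, B (t + Δ) ω * (X t ω - m) ∂P := by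
    have h := hX.forcing_le_integral_mul_increment hB hb.le hσ.le le_rfl hu.le ht.le
    simp only [hB.2.1, sub_zero, min_eq_right ht.le] at h
    rw [hBZ _ hu.le]
    have : 0 < min t (t + Δ) := lt_min ht hu
    exact lt_of_lt_of_le (by positivity) h
  have hcov : rcov P (X t) (X (t + Δ)) = ∫ ω, X (t + Δ) ω * (X t ω - m) ∂P := by
    have h1 : Integrable (fun ω => X t ω * X (t + Δ) ω) P := hXt.integrable_mul hXu
    have h2 : Integrable (fun ω => m * X (t + Δ) ω) P :=
      (hXu.integrable one_le_two).const_mul m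
    simp_rw [mul_comm (X (t + Δ) _), sub_mul]
    rw [integral_sub h1 h2, integral_const_mul, rcov]
  rw [hcov]
  refine lt_of_lt_of_le ?_ (hX.forcing_le_integral_mul hB hb.le hσ.le
    ((hX.measurable ht.le).sub_const m) hZ hZ0 hmono hu.le)
  positivity
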